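/- Let L be a pseudodifferential operator in ∂ over a commutative differential algebra V such that ∂L is self-adjoint (equivalently ∂L = −L*∂), and let u ∈ V. Then the operator ∂·[L, ∂⁻¹u] = ∂L∂⁻¹u − u∂⁻¹∂L is again self-adjoint. -/

import Mathlib

/-- **Self-adjointness of `∂·[L, ∂⁻¹u]`** (used to show the defining relations of the
coupled BKP hierarchy are well defined).

`R` models the ring `V((∂⁻¹))` of pseudodifferential operators in `∂` over a commutative
differential algebra `V`; `ι` embeds `V`, `d` is the invertible derivation symbol with
Leibniz rule for the derivation `δ`, and the adjoint is the star operation determined by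
`∂* = -∂`, `v* = v` and `(PQ)* = Q*P*`.  If `∂L` is self-adjoint then so is
`∂·[L, ∂⁻¹u] = ∂L∂⁻¹u - u∂⁻¹∂L`. -/
theorem self_adjoint_d_commutator_dinv_u
    {V R : Type*} [CommRing V] [Algebra ℂ V]
    [Ring R] [StarRing R]
    (ι : V →+* R) (hι : Function.Injective ι)
    (d : Rˣ)
    (δ : Derivation ℂ V V)
    (hleib : ∀ v : V, (d : R) * ι v = ι v * (d : R) + ι (δ v))
    (hstar_d : star ((d : R)) = -(d : R))
    (hstar_ι : ∀ v : V, star (ι v) = ι v)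
    (L : R) (u : V)
    (hL : star ((d : R) * L) = (d : R) * L) :
    star ((d : R) * (L * (((d⁻¹ : Rˣ) : R) * ι u) - (((d⁻¹ : Rˣ) : R) * ι u) * L))
      = (d : R) * (L * (((d⁻¹ : Rˣ) : R) * ι u) - (((d⁻¹ : Rˣ) : R) * ι u) * L) := by
  have hstar_inv : star ((d⁻¹ : Rˣ) : R) = -((d⁻¹ : Rˣ) : R) := by
    have h : star d = -d := Units.ext hstar_d
    rw [← Units.coe_star, star_inv, h, inv_neg, Units.val_neg]
  have hdecomp : (d : R) * (L * (((d⁻¹ : Rˣ) : R) * ι u) - (((d⁻¹ : Rˣ) : R) * ι u) * L)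
      = (d : R) * L * ((d⁻¹ : Rˣ) : R) * ι u
        - ι u * (((d⁻¹ : Rˣ) : R) * ((d : R) * L)) := by
    rw [Units.inv_mul_cancel_left, mul_sub, mul_assoc _ (ι u) L, Units.mul_inv_cancel_left]
    simp only [mul_assoc]
  rw [hdecomp]
  generalize (d : R) * L = M at hL
  simp only [star_sub, star_mul, hL, hstar_inv, hstar_ι]
  noncomm_ring
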